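/- arXiv:1408.5512 — 6 statements merged into one kernel-verified Lean document; each statement's English description precedes it below -/
import Mathlib

section
/- Let K be a field of characteristic zero, let n, m ≥ 1 be integers, and let v₁, …, vₙ ∈ K^{n+m} be linearly independent over K. Then the determinant Δ := det(w₁, …, w_m, v₁, …, vₙ) of the (n+m)×(n+m) matrix over K[x₁,…,xₙ] whose first m columns are the pattern vectors w₁, …, w_m and whose last n columns are (the images in (K[x₁,…,xₙ])^{n+m} of) v₁, …, vₙ is a nonzero polynomial in K[x₁,…,xₙ]. -/
/-- The `(n+m) × (n+m)` matrix over `K[x₁,…,xₙ]` whose first `m` columns are the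
pattern vectors `w₁, …, w_m` (with `(w_j)_i = x_{i-j+1}` for `j ≤ i ≤ j+n-1`,
`(w_j)_{j+n} = 1`, and `0` otherwise, in 1-based notation), and whose last `n`
columns are the images of the constant vectors `v₁, …, vₙ ∈ K^{n+m}`.
Indices are 0-based. -/
noncomputable def patMatrix (K : Type) [Field K] (n m : ℕ) (v : Fin n → Fin (n + m) → K) :
    Matrix (Fin (n + m)) (Fin (n + m)) (MvPolynomial (Fin n) K) :=
  fun i j =>
    if _hj : (j : ℕ) < m then
      -- the pattern vector `w_{j+1}`
      if h : (j : ℕ) ≤ (i : ℕ) ∧ (i : ℕ) - (j : ℕ) < n then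
        MvPolynomial.X ⟨(i : ℕ) - (j : ℕ), h.2⟩
      else if (i : ℕ) = (j : ℕ) + n then 1 else 0
    else
      -- the constant vector `v_{j-m+1}`
      MvPolynomial.C (v ⟨(j : ℕ) - m, by have := j.isLt; omega⟩ i)

/-- Linearly independent functions `f₁, …, fₙ` on a set admit points `a₁, …, aₙ` at which
the evaluation map on their span is injective. -/
theorem exists_points_forall_sum_eq_zero {K X ι : Type*} [Field K] [Fintype ι]
    (f : ι → X → K) (hf : LinearIndependent K f) :
    ∃ a : ι → X, ∀ c : ι → K, (∀ i, ∑ j, c j * f j (a i) = 0) → c = 0 := by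
  classical
  obtain ⟨κ, b, -, hspan, hli⟩ := exists_linearIndependent' K (fun x : X => fun j => f j x)
  have htop : Submodule.span K (Set.range fun x : X => fun j => f j x) = ⊤ := by
    by_contra hne
    obtain ⟨φ, hφ, hle⟩ := Submodule.exists_le_ker_of_lt_top _ (lt_top_iff_ne_top.2 hne)
    refine hφ ((Pi.basisFun K ι).ext fun j => ?_)
    have hsum : ∑ i, φ (Pi.single i 1) • f i = 0 := by
      ext x
      have hx : φ (fun j => f j x) = 0 := hle (Submodule.subset_span ⟨x, rfl⟩)
      rw [LinearMap.pi_apply_eq_sum_univ φ] at hx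
      have hsingle (i : ι) : (Pi.single i 1 : ι → K) = fun j => if i = j then 1 else 0 := by
        ext j
        simp [Pi.single_apply, eq_comm]
      simpa [hsingle, mul_comm] using hx
    simpa using Fintype.linearIndependent_iff.1 hf _ hsum j
  let e := (Module.Basis.mk hli (by rw [hspan, htop])).indexEquiv (Pi.basisFun K ι)
  refine ⟨fun i => b (e.symm i), fun c hc => ?_⟩
  have hrows : LinearIndependent K (Matrix.of fun i j => f j (b (e.symm i))).row :=
    hli.comp e.symm e.symm.injective
  apply Matrix.mulVec_injective_of_isUnit (Matrix.linearIndependent_rows_iff_isUnit.1 hrows)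
  ext i
  simpa [Matrix.mulVec, dotProduct, mul_comm] using hc i

open Polynomial in
/-- The pattern columns, specialized at the lower coefficients of a monic polynomial `p` of
degree `n`, are the coefficient vectors of the polynomials `X ^ j * p`. -/
theorem ofFn_eval_patMatrix_pattern {K : Type} [Field K] [DecidableEq K] {n m : ℕ}
    (v : Fin n → Fin (n + m) → K) {p : K[X]} (hp : p.Monic) (hdeg : p.natDegree = n)
    (j : Fin (n + m)) (hj : (j : ℕ) < m) :
    ofFn (n + m) (fun i => MvPolynomial.eval (fun k : Fin n => p.coeff k)
      (patMatrix K n m v i j)) = X ^ (j : ℕ) * p := by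
  have hlead : p.coeff n = 1 := hdeg ▸ hp.coeff_natDegree
  ext k
  rw [coeff_X_pow_mul']
  by_cases hk : k < n + m
  · rw [ofFn_coeff_eq_val_of_lt _ hk]
    simp only [patMatrix, dif_pos hj]
    split_ifs with h1 h2 h3 h4 h5
    · simp
    · omega
    · simp [h3, hlead]
    · omega
    · rw [map_zero, coeff_eq_zero_of_natDegree_lt (by omega)]
    · simp
  · rw [ofFn_coeff_eq_zero_of_ge _ (by omega), if_pos (by omega),
      coeff_eq_zero_of_natDegree_lt (by omega)]

/-- Lemma on determinants: if `v₁, …, vₙ ∈ K^{n+m}` are linearly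
independent over a field `K` of characteristic zero, then
`Δ = det(w₁, …, w_m, v₁, …, vₙ)` is a nonzero polynomial in `K[x₁,…,xₙ]`. -/
theorem det_pattern_matrix_ne_zero (K : Type) [Field K] [CharZero K]
    (n m : ℕ) (hn : 1 ≤ n) (hm : 1 ≤ m)
    (v : Fin n → Fin (n + m) → K) (hv : LinearIndependent K v) :
    (patMatrix K n m v).det ≠ 0 := by
  classical
  have hli : LinearIndependent K (fun j x => (Polynomial.ofFn (n + m) (v j)).eval x) := by
    rw [Fintype.linearIndependent_iff] at hv ⊢
    intro g hg
    refine hv g (Polynomial.injective_ofFn (n + m) (Polynomial.funext fun x => ?_))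
    simpa [Polynomial.eval_finsetSum] using congrFun hg x
  obtain ⟨a, ha⟩ := exists_points_forall_sum_eq_zero _ hli
  let p : Polynomial K := ∏ i, (Polynomial.X - Polynomial.C (a i))
  have hp : p.Monic := Polynomial.monic_prod_X_sub_C a Finset.univ
  have hdeg : p.natDegree = n := by simp [p]
  have hroot (i : Fin n) : p.eval (a i) = 0 := by
    rw [Polynomial.eval_prod]
    exact Finset.prod_eq_zero (Finset.mem_univ i) (by simp)
  intro hdet
  let φ := MvPolynomial.eval (fun k : Fin n => p.coeff k)
  have hφ : ((patMatrix K n m v).map φ).det = 0 := by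
    rw [← RingHom.mapMatrix_apply, ← RingHom.map_det, hdet, map_zero]
  obtain ⟨c, hc, hMc⟩ := Matrix.exists_mulVec_eq_zero_iff.2 hφ
  let e : Fin (m + n) ≃ Fin (n + m) := finCongr (Nat.add_comm m n)
  have hcols : ∑ j, c j • Polynomial.ofFn (n + m) (fun i => φ (patMatrix K n m v i j)) = 0 := by
    rw [← map_zero (Polynomial.ofFn (n + m)), ← hMc]
    simp_rw [← map_smul, ← map_sum]
    congr 1
    ext i
    simp [Matrix.mulVec, dotProduct, mul_comm]
  have hconst (k : Fin n) :
      (fun i => φ (patMatrix K n m v i (e (Fin.natAdd m k)))) = v k := by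
    ext i
    simp [patMatrix, e, φ]
  rw [← e.sum_comp, Fin.sum_univ_add] at hcols
  simp_rw [hconst] at hcols
  have hpat (j : Fin m) : Polynomial.ofFn (n + m)
      (fun i => φ (patMatrix K n m v i (e (Fin.castAdd n j)))) = Polynomial.X ^ (j : ℕ) * p :=
    ofFn_eval_patMatrix_pattern v hp hdeg _ j.isLt
  simp_rw [hpat] at hcols
  have hc_const : (fun k => c (e (Fin.natAdd m k))) = 0 := by
    refine ha _ fun i => ?_
    simpa [Polynomial.eval_finsetSum, hroot] using congrArg (Polynomial.eval (a i)) hcols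
  have hc_const' (k : Fin n) : c (e (Fin.natAdd m k)) = 0 := congrFun hc_const k
  have hq : (Polynomial.ofFn m fun j => c (e (Fin.castAdd n j))) * p = 0 := by
    simpa [hc_const', Polynomial.ofFn_eq_sum_monomial, Finset.sum_mul,
      ← Polynomial.C_mul_X_pow_eq_monomial, Polynomial.smul_eq_C_mul, mul_assoc] using hcols
  have hc_pat : (fun j => c (e (Fin.castAdd n j))) = 0 :=
    Polynomial.injective_ofFn m <| by
      simpa using (mul_eq_zero.1 hq).resolve_right hp.ne_zero
  refine hc (funext fun j => ?_)
  obtain ⟨j, rfl⟩ := e.surjective j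
  induction j using Fin.addCases with
  | left j => exact congrFun hc_pat j
  | right k => exact hc_const' k
end

section
/- Let K be a field of characteristic zero, let n, m ≥ 1 be integers, and let v₁, …, vₙ ∈ K^{n+m} be linearly independent over K. Then the n+m columns w₁, …, w_m, v₁, …, vₙ are linearly independent over the rational function field K(x₁,…,xₙ); equivalently, they form a basis of the vector space K(x₁,…,xₙ)^{n+m}. -/
open Polynomial in
/-- A vector orthogonal to all `(1, r, r², …)` over an infinite field is zero. -/
theorem eq_zero_of_forall_sum_mul_pow_eq_zero {K : Type*} [Field K] [Infinite K] {N : ℕ}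
    (u : Fin N → K) (h : ∀ r : K, ∑ i, u i * r ^ (i : ℕ) = 0) : u = 0 := by
  have hp : (∑ i : Fin N, C (u i) * X ^ (i : ℕ) : K[X]) = 0 := by
    refine Polynomial.funext fun r => ?_
    simpa [eval_finsetSum] using h r
  ext i
  have := congrArg (fun p => coeff p i) hp
  simpa [finsetSum_coeff, coeff_C_mul, coeff_X_pow, Fin.val_inj] using this

/-- If no nonzero linear combination of `n` functions vanishes identically, then some `n` points
separate their linear combinations. -/
theorem exists_points_separating {K X : Type*} [Field K] {n : ℕ} (f : Fin n → X → K)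
    (hf : ∀ c : Fin n → K, (∀ x, ∑ j, c j * f j x = 0) → c = 0) :
    ∃ r : Fin n → X, ∀ c : Fin n → K, (∀ k, ∑ j, c j * f j (r k) = 0) → c = 0 := by
  let g : X → Fin n → K := fun x j => f j x
  have hspan : Submodule.span K (Set.range g) = ⊤ := by
    by_contra hne
    obtain ⟨φ, hφ, hle⟩ := Submodule.exists_le_ker_of_lt_top _ (lt_top_iff_ne_top.mpr hne)
    have happ : ∀ y, φ y = ∑ j, φ (Pi.single j 1) * y j := fun y => by
      rw [LinearMap.pi_apply_eq_sum_univ φ y]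
      refine Finset.sum_congr rfl fun j _ => ?_
      rw [smul_eq_mul, mul_comm]
      congr 2
      ext i
      simp [Pi.single_apply, eq_comm]
    have hz := hf (fun j => φ (Pi.single j 1)) fun x => by
      rw [← happ (g x)]
      exact hle (Submodule.subset_span ⟨x, rfl⟩)
    refine hφ (LinearMap.ext fun y => ?_)
    rw [happ]
    simpa using Finset.sum_eq_zero fun j _ => by rw [congrFun hz j]; simp
  obtain ⟨s, hs, hsp, hli⟩ := exists_linearIndependent K (Set.range g)
  let b : Module.Basis s K (Fin n → K) := Module.Basis.mk hli (by simp [hsp, hspan])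
  have : Fintype s := FiniteDimensional.fintypeBasisIndex b
  have hcard : Fintype.card s = n := by
    rw [← Module.finrank_eq_card_basis b]; simp
  let e : Fin n ≃ s := (Fintype.equivFinOfCardEq hcard).symm
  choose r hr using fun k => hs (e k).2
  refine ⟨r, fun c hc => ?_⟩
  have hz : (Fintype.linearCombination K c : (Fin n → K) →ₗ[K] K) = 0 := by
    refine b.ext fun x => ?_
    obtain ⟨k, rfl⟩ := e.surjective x
    have : b (e k) = g (r k) := by rw [hr k]; simp [b]
    rw [this]
    simpa [Fintype.linearCombination_apply, g, mul_comm] using hc k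
  ext j
  simpa using LinearMap.congr_fun hz (Pi.single j 1)

open Polynomial in
/-- Specialising `x₁,…,xₙ` to the lower coefficients of a monic polynomial `p` of degree `n` turns
the pattern vectors into the coefficient vectors of `p, X p, X² p, …`. -/
theorem eval_patMatrix_of_lt {K : Type} [Field K] {n m : ℕ} (v : Fin n → Fin (n + m) → K)
    {p : K[X]} (hp : p.Monic) (hdeg : p.natDegree = n) (i j : Fin (n + m)) (hj : (j : ℕ) < m) :
    MvPolynomial.eval (fun k : Fin n => p.coeff k) (patMatrix K n m v i j) =
      (X ^ (j : ℕ) * p).coeff i := by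
  rw [coeff_X_pow_mul', patMatrix, dif_pos hj]
  split_ifs with h₁ h₂ h₃ h₄ h₅
  · simp
  · exact absurd h₁.1 h₂
  · rw [h₃, Nat.add_sub_cancel_left, ← hdeg, hp.coeff_natDegree, map_one]
  · omega
  · rw [coeff_eq_zero_of_natDegree_lt (by omega), map_zero]
  · exact map_zero _

open Polynomial in
/-- The pattern matrix is nonsingular when the constant columns are linearly independent. -/
theorem det_patMatrix_ne_zero {K : Type} [Field K] [Infinite K] {n m : ℕ}
    (v : Fin n → Fin (n + m) → K) (hv : LinearIndependent K v) :
    (patMatrix K n m v).det ≠ 0 := by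
  obtain ⟨r, hr⟩ := exists_points_separating
    (fun (j : Fin n) (x : K) => ∑ i, v j i * x ^ (i : ℕ)) fun c hc => by
      have hz := eq_zero_of_forall_sum_mul_pow_eq_zero (∑ j, c j • v j) fun x => by
        rw [← hc x]
        simp only [Finset.sum_apply, Pi.smul_apply, smul_eq_mul, Finset.sum_mul, Finset.mul_sum,
          mul_assoc]
        exact Finset.sum_comm
      exact funext (Fintype.linearIndependent_iff.mp hv c hz)
  let p : K[X] := ∏ k, (X - C (r k))
  have hp : p.Monic := monic_prod_of_monic _ _ fun k _ => monic_X_sub_C (r k)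
  have hdeg : p.natDegree = n := by simp [p]
  let φ := MvPolynomial.eval fun k : Fin n => p.coeff k
  have hlow := eval_patMatrix_of_lt v hp hdeg
  intro hdet
  have hdet' : ((patMatrix K n m v).map φ).det = 0 := by
    rw [← RingHom.mapMatrix_apply, ← RingHom.map_det, hdet, map_zero]
  obtain ⟨c, hc0, hc⟩ := Matrix.exists_mulVec_eq_zero_iff.mpr hdet'
  have hrow : ∀ i, ∑ j, φ (patMatrix K n m v i j) * c j = 0 := fun i => congrFun hc i
  have hhigh : (fun l : Fin n => c ⟨m + l, by omega⟩) = 0 := hr _ fun k => by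
    have hsum : ∑ j, (∑ i : Fin (n + m), φ (patMatrix K n m v i j) * r k ^ (i : ℕ)) * c j = 0 := by
      calc _ = ∑ i : Fin (n + m), r k ^ (i : ℕ) * ∑ j, φ (patMatrix K n m v i j) * c j := by
            simp only [Finset.sum_mul, Finset.mul_sum]
            rw [Finset.sum_comm]
            exact Finset.sum_congr rfl fun _ _ => Finset.sum_congr rfl fun _ _ => by ring
        _ = 0 := by simp [hrow]
    rw [← (finCongr (Nat.add_comm m n)).sum_comp, Fin.sum_univ_add, Finset.sum_eq_zero,
      zero_add] at hsum
    · rw [← hsum]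
      refine Finset.sum_congr rfl fun l _ => ?_
      rw [mul_comm]
      congr 1
      refine Finset.sum_congr rfl fun i _ => ?_
      simp [patMatrix, φ]
    · intro l _
      have hd : (X ^ (l : ℕ) * p).natDegree < n + m := by
        rw [(monic_X_pow _).natDegree_mul hp, natDegree_X_pow, hdeg]; omega
      have hroot : (X ^ (l : ℕ) * p).eval (r k) = 0 := by
        rw [eval_mul, eval_prod, Finset.prod_eq_zero (Finset.mem_univ k) (by simp), mul_zero]
      rw [eval_eq_sum_range' hd, Finset.sum_range] at hroot
      rw [Finset.sum_congr rfl fun i _ => by rw [hlow i _ (by simp)]]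
      simpa using Or.inl hroot
  have hlast : ∀ (d : ℕ) (j : Fin (n + m)), n + m - j = d → c j = 0 := by
    intro d
    induction d using Nat.strong_induction_on with
    | _ d ih =>
      intro j hjd
      rcases lt_or_ge (j : ℕ) m with hj | hj
      · have h := hrow ⟨j + n, by omega⟩
        rw [Finset.sum_eq_single j] at h
        · rw [hlow _ _ hj, coeff_X_pow_mul', if_pos (by simp)] at h
          have h1 := hp.coeff_natDegree
          rw [hdeg] at h1
          simpa [h1] using h
        · intro j' _ hne
          have hne' : (j' : ℕ) ≠ j := fun h => hne (Fin.ext h)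
          rcases lt_or_ge (j' : ℕ) j with hlt | hge
          · rw [hlow _ _ (by omega), coeff_X_pow_mul']
            rw [if_pos (by simp; omega), coeff_eq_zero_of_natDegree_lt (by simp; omega), zero_mul]
          · rw [ih (n + m - j') (by omega) j' rfl, mul_zero]
        · simp
      · have h := congrFun hhigh ⟨j - m, by omega⟩
        simpa [Nat.add_sub_cancel' hj] using h
  exact hc0 (funext fun j => hlast _ j rfl)

/-- if `v₁, …, vₙ ∈ K^{n+m}` are linearly independent over a field
`K` of characteristic zero, then the `n+m` columns `w₁, …, w_m, v₁, …, vₙ`, viewed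
over the rational function field `K(x₁,…,xₙ)` (the fraction field of `K[x₁,…,xₙ]`),
are linearly independent over `K(x₁,…,xₙ)`. -/
theorem pattern_columns_linearIndependent (K : Type) [Field K] [CharZero K]
    (n m : ℕ) (hn : 1 ≤ n) (hm : 1 ≤ m)
    (v : Fin n → Fin (n + m) → K) (hv : LinearIndependent K v) :
    LinearIndependent (FractionRing (MvPolynomial (Fin n) K))
      (fun (j : Fin (n + m)) (i : Fin (n + m)) =>
        algebraMap (MvPolynomial (Fin n) K) (FractionRing (MvPolynomial (Fin n) K))
          (patMatrix K n m v i j)) := by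
  refine Matrix.linearIndependent_cols_of_det_ne_zero
    (A := (algebraMap (MvPolynomial (Fin n) K)
      (FractionRing (MvPolynomial (Fin n) K))).mapMatrix (patMatrix K n m v)) ?_
  rw [← RingHom.map_det]
  exact (map_ne_zero_iff _ (IsFractionRing.injective _ _)).mpr (det_patMatrix_ne_zero v hv)
end

section
/- Let K be a field of characteristic zero, let m ≥ 1 be an integer, and let v ∈ K^{1+m} be a nonzero vector. With n = 1, so that the pattern vectors are w_j = x₁·e_j + e_{j+1} ∈ (K[x₁])^{1+m} for j = 1, …, m (where e_i denotes the i-th standard basis vector), the determinant det(w₁, …, w_m, v) of the (1+m)×(1+m) matrix with columns w₁, …, w_m and (the image of) v is a nonzero polynomial in K[x₁]. -/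
theorem patMatrix_one_left_kernel {K : Type} [Field K] {m : ℕ} {v : Fin 1 → Fin (1 + m) → K}
    {u : Fin (1 + m) → MvPolynomial (Fin 1) K} (hu : Matrix.vecMul u (patMatrix K 1 m v) = 0)
    (k : ℕ) (hk : k < 1 + m) :
    u ⟨k, hk⟩ = (-MvPolynomial.X 0) ^ k * u ⟨0, by omega⟩ := by
  induction k with
  | zero => simp
  | succ k ih =>
    have hk' : k < 1 + m := by omega
    have hcol := congrFun hu ⟨k, hk'⟩
    have hne : (⟨k, hk'⟩ : Fin (1 + m)) ≠ ⟨k + 1, hk⟩ := by simp [Fin.ext_iff]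
    rw [Matrix.vecMul, dotProduct, Finset.sum_eq_add _ _ hne] at hcol
    · have hkm : k < m := by omega
      simp [patMatrix, hkm] at hcol
      rw [ih hk'] at hcol
      linear_combination hcol
    · rintro ⟨c, hc⟩ - ⟨h₁, h₂⟩
      simp only [ne_eq, Fin.ext_iff] at h₁ h₂
      have hkm : k < m := by omega
      have h₃ : ¬ (k ≤ c ∧ c - k < 1) := by omega
      simp only [patMatrix, hkm, h₂, dite_true, dif_neg h₃, if_false, mul_zero]
    · simp
    · simp

/-- base case `n = 1`: for a nonzero vector `v ∈ K^{1+m}`,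
the determinant `det(w₁, …, w_m, v)` with pattern vectors `w_j = x₁·e_j + e_{j+1}`
is a nonzero polynomial in `K[x₁]`. -/
theorem det_pattern_matrix_ne_zero_base_n (K : Type) [Field K] [CharZero K]
    (m : ℕ) (hm : 1 ≤ m) (v : Fin (1 + m) → K) (hv : v ≠ 0) :
    (patMatrix K 1 m (fun _ => v)).det ≠ 0 := by
  intro hdet
  obtain ⟨u, hu₀, hu⟩ := Matrix.exists_vecMul_eq_zero_iff.mpr hdet
  have hgeom (i : Fin (1 + m)) := patMatrix_one_left_kernel hu i i.isLt
  have hne : u ⟨0, by omega⟩ ≠ 0 := fun h => hu₀ (funext fun i => by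
    rw [show u i = _ from hgeom i, h, mul_zero, Pi.zero_apply])
  have hcol := congrFun hu ⟨m, by omega⟩
  have hsum : ∑ i : Fin (1 + m), (-MvPolynomial.X 0) ^ (i : ℕ) * MvPolynomial.C (v i) =
      (0 : MvPolynomial (Fin 1) K) := by
    refine (mul_eq_zero.mp ?_).resolve_left hne
    rw [← show _ = (0 : MvPolynomial (Fin 1) K) from hcol, Matrix.vecMul, dotProduct,
      Finset.mul_sum]
    refine Finset.sum_congr rfl fun i _ => ?_
    rw [show u i = _ from hgeom i]
    simp only [patMatrix, lt_irrefl, dite_false]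
    ring
  have hpoly := congrArg (MvPolynomial.aeval fun _ => -(Polynomial.X : Polynomial K)) hsum
  apply hv
  funext j
  have hcoeff := congrArg (fun p => Polynomial.coeff p j) hpoly
  simpa [Polynomial.finsetSum_coeff, ← Polynomial.C_eq_algebraMap, Polynomial.coeff_X_pow,
    ← Fin.ext_iff] using hcoeff
end

section
/- Let K be a field of characteristic zero, let n ≥ 2 and m ≥ 1 be integers, and let v₁, …, vₙ ∈ K^{n+m} be vectors with v_{1,1} arbitrary and v_{1,j} = 0 for j = 2, …, n (where v_{1,j} denotes the first coordinate of v_j). Let Δ = det(w₁, …, w_m, v₁, …, vₙ) be the determinant of the (n+m)×(n+m) pattern matrix over K[x₁,…,xₙ]. Then the evaluation of Δ at x₁ = 0 satisfies Δ(0, x₂, …, xₙ) = (−1)^m · v_{1,1} · det(w′₁, …, w′_m, v̄₂, …, v̄ₙ), where v̄₂, …, v̄ₙ ∈ K^{(n−1)+m} are obtained from v₂, …, vₙ by deleting the first coordinate, and w′₁, …, w′_m ∈ (K[x₂,…,xₙ])^{(n−1)+m} are the pattern vectors for the parameters (n−1, m) in the variables x₂, …, xₙ. -/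
/-- Laplace expansion of a determinant along a first row with at most one nonzero entry. -/
theorem Matrix.det_eq_of_row_zero_eq_zero {R : Type*} [CommRing R] {N k : ℕ} (hN : N = k + 1)
    (M : Matrix (Fin N) (Fin N) R) (p : Fin N)
    (hrow : ∀ j, j ≠ p → M ⟨0, by omega⟩ j = 0) :
    M.det = (-1) ^ (p : ℕ) * M ⟨0, by omega⟩ p *
      (Matrix.of fun i j : Fin k =>
        M ⟨i + 1, by omega⟩ ⟨if (j : ℕ) < p then j else j + 1, by split_ifs <;> omega⟩).det := by
  subst hN
  rw [Matrix.det_succ_row_zero, Finset.sum_eq_single p]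
  · congr 2
    ext i j
    simp only [Matrix.submatrix_apply, Matrix.of_apply]
    congr 1
    ext
    simp only [Fin.succAbove, Fin.lt_def, Fin.val_castSucc]
    split_ifs <;> simp
  · intro j _ hj
    have h := hrow j hj
    rw [Fin.mk_zero] at h
    simp [h]
  · simp

/-- inductive step, Case 2: let `n ≥ 2`, `m ≥ 1`, and let
`v₁, …, vₙ ∈ K^{n+m}` have `v_{1,j} = 0` for `j = 2, …, n` (first coordinates of
`v₂, …, vₙ` vanish; the first coordinate `v_{1,1}` of `v₁` is arbitrary).  Then
evaluating `Δ = det(w₁, …, w_m, v₁, …, vₙ)` at `x₁ = 0` (keeping `x₂, …, xₙ`,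
which become the `n-1` variables of `K[x₂,…,xₙ]`) yields
`Δ(0, x₂, …, xₙ) = (-1)^m · v_{1,1} · det(w′₁, …, w′_m, v̄₂, …, v̄ₙ)`,
where `v̄₂, …, v̄ₙ ∈ K^{(n-1)+m}` are obtained by deleting the first coordinate and
`w′₁, …, w′_m` are the pattern vectors for the parameters `(n-1, m)`. -/
theorem det_pattern_matrix_eval_x1_zero (K : Type) [Field K] [CharZero K]
    (n m : ℕ) (hn : 2 ≤ n) (hm : 1 ≤ m)
    (v : Fin n → Fin (n + m) → K)
    (h0 : ∀ j : Fin n, 1 ≤ (j : ℕ) → v j ⟨0, by omega⟩ = 0) :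
    MvPolynomial.aeval
        (fun i : Fin n =>
          if _h : (i : ℕ) = 0 then (0 : MvPolynomial (Fin (n - 1)) K)
          else MvPolynomial.X ⟨(i : ℕ) - 1, by have := i.isLt; omega⟩)
        (patMatrix K n m v).det
      = (-1) ^ m * MvPolynomial.C (v ⟨0, by omega⟩ ⟨0, by omega⟩) *
          (patMatrix K (n - 1) m
            (fun (i : Fin (n - 1)) (k : Fin ((n - 1) + m)) =>
              v ⟨(i : ℕ) + 1, by have := i.isLt; omega⟩
                ⟨(k : ℕ) + 1, by have := k.isLt; omega⟩)).det := by
  obtain ⟨n, rfl⟩ : ∃ k, n = k + 1 := ⟨n - 1, by omega⟩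
  rw [AlgHom.map_det, Matrix.det_eq_of_row_zero_eq_zero (k := n + m) (by omega) _ ⟨m, by omega⟩]
  · congr 2
    · simp [patMatrix]
    · ext i j : 1
      have hi := i.isLt
      have hj := j.isLt
      by_cases hjm : (j : ℕ) < m
      · simp only [AlgHom.mapMatrix_apply, Matrix.map_apply, Matrix.of_apply, patMatrix, hjm,
          if_true, dif_pos]
        split_ifs <;> first | omega | skip
        all_goals simp <;> grind
      · have h1 : ¬ (j : ℕ) + 1 < m := by omega
        have h2 : (j : ℕ) + 1 - m = j - m + 1 := by omega
        simp [patMatrix, hjm, h1, h2, MvPolynomial.algebraMap_eq]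
  · intro j hj
    have hjm : (j : ℕ) ≠ m := fun h => hj (Fin.ext h)
    by_cases h : (j : ℕ) < m
    · simp only [AlgHom.mapMatrix_apply, Matrix.map_apply, patMatrix, h, dif_pos]
      split_ifs <;> simp_all
    · have h1 := h0 ⟨j - m, by omega⟩ (by simp only; omega)
      simp only [AlgHom.mapMatrix_apply, Matrix.map_apply, patMatrix, h, dif_neg,
        not_false_eq_true, h1, map_zero]
end

section
/- Let K be a field of characteristic zero, let n, m ≥ 1 be integers, and let v₁, …, vₙ ∈ K^{n+m} be linearly independent over K. Then there exists a nonzero polynomial Δ ∈ K[x₁,…,xₙ] such that for every point a = (a₁,…,aₙ) ∈ Kⁿ with Δ(a) ≠ 0, the specialized pattern vectors w₁(a), …, w_m(a) ∈ K^{n+m} together with v₁, …, vₙ form a basis of K^{n+m}. In particular, since a field of characteristic zero is infinite, there exists at least one a ∈ Kⁿ for which w₁(a), …, w_m(a), v₁, …, vₙ are linearly independent over K. -/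
/-- The `(n+m) × (n+m)` matrix over `K` whose first `m` columns are the pattern
vectors `w₁, …, w_m` specialized at the point `a ∈ Kⁿ` (substituting `x_i := a_i`)
and whose last `n` columns are the vectors `v₁, …, vₙ ∈ K^{n+m}`.
Indices are 0-based. -/
def specPatMatrix (K : Type) [Field K] (n m : ℕ) (a : Fin n → K)
    (v : Fin n → Fin (n + m) → K) :
    Matrix (Fin (n + m)) (Fin (n + m)) K :=
  fun i j =>
    if _hj : (j : ℕ) < m then
      if h : (j : ℕ) ≤ (i : ℕ) ∧ (i : ℕ) - (j : ℕ) < n then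
        a ⟨(i : ℕ) - (j : ℕ), h.2⟩
      else if (i : ℕ) = (j : ℕ) + n then 1 else 0
    else
      v ⟨(j : ℕ) - m, by have := j.isLt; omega⟩ i

/-- Linearly independent functions `f₁, …, fₙ` on a set admit `n` points at which their
evaluation matrix has linearly independent rows. -/
theorem exists_points_linearIndependent_eval {K X : Type*} [Field K] {n : ℕ}
    {f : Fin n → X → K} (hf : LinearIndependent K f) :
    ∃ t : Fin n → X, LinearIndependent K (fun i k => f k (t i)) := by
  let s : Set (Fin n → K) := Set.range fun x k => f k x
  have hspan : Submodule.span K s = ⊤ := by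
    by_contra hne
    obtain ⟨φ, hφ, hker⟩ := Submodule.exists_le_ker_of_lt_top _ (lt_top_iff_ne_top.2 hne)
    apply hφ
    have hsum : ∑ k, φ (fun j => if k = j then 1 else 0) • f k = 0 := by
      funext x
      have hx : φ (fun k => f k x) = 0 := hker (Submodule.subset_span ⟨x, rfl⟩)
      rw [LinearMap.pi_apply_eq_sum_univ] at hx
      simpa [Finset.sum_apply, mul_comm] using hx
    have hzero := Fintype.linearIndependent_iff.1 hf _ hsum
    refine LinearMap.ext fun y => ?_
    simp [LinearMap.pi_apply_eq_sum_univ φ y, hzero]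
  obtain ⟨g, hg, -, hind⟩ := Submodule.exists_fun_fin_finrank_span_eq K s
  have hrank : Module.finrank K (Submodule.span K s) = n := by
    rw [hspan, finrank_top, Module.finrank_fin_fun]
  choose t ht using hg
  refine ⟨fun i => t (Fin.cast hrank.symm i), ?_⟩
  have hg : (fun i k => f k (t i)) = g := funext ht
  rw [← hg] at hind
  exact hind.comp _ (Fin.cast_injective hrank.symm)

/-- The pattern matrix with indeterminates in place of the coordinates of the point `a`. -/
noncomputable def genericPatMatrix (K : Type) [Field K] (n m : ℕ)
    (v : Fin n → Fin (n + m) → K) :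
    Matrix (Fin (n + m)) (Fin (n + m)) (MvPolynomial (Fin n) K) :=
  fun i j =>
    if _hj : (j : ℕ) < m then
      if h : (j : ℕ) ≤ (i : ℕ) ∧ (i : ℕ) - (j : ℕ) < n then
        MvPolynomial.X ⟨(i : ℕ) - (j : ℕ), h.2⟩
      else if (i : ℕ) = (j : ℕ) + n then 1 else 0
    else
      MvPolynomial.C (v ⟨(j : ℕ) - m, by have := j.isLt; omega⟩ i)

theorem eval_det_genericPatMatrix (K : Type) [Field K] (n m : ℕ) (a : Fin n → K)
    (v : Fin n → Fin (n + m) → K) :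
    MvPolynomial.eval a (genericPatMatrix K n m v).det = (specPatMatrix K n m a v).det := by
  rw [RingHom.map_det]
  congr 1
  ext i j
  simp only [RingHom.mapMatrix_apply, Matrix.map_apply, genericPatMatrix, specPatMatrix]
  split_ifs <;> simp

open Classical in
/-- At the coefficients of a monic polynomial `f` of degree `n`, the pattern columns are the
coefficient vectors of the polynomials `X ^ j * f`. -/
theorem ofFn_specPatMatrix_of_lt {K : Type} [Field K] {n m : ℕ} {f : Polynomial K}
    (hf : f.Monic) (hdeg : f.natDegree = n) (v : Fin n → Fin (n + m) → K)
    {j : Fin (n + m)} (hj : (j : ℕ) < m) :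
    Polynomial.ofFn (n + m) (fun i => specPatMatrix K n m (fun i => f.coeff i) v i j) =
      Polynomial.X ^ (j : ℕ) * f := by
  have hlead : f.coeff n = 1 := hdeg ▸ hf.coeff_natDegree
  have hhigh : ∀ k, n < k → f.coeff k = 0 := fun k hk =>
    Polynomial.coeff_eq_zero_of_natDegree_lt (hdeg ▸ hk)
  ext i
  rw [Polynomial.coeff_X_pow_mul']
  rcases lt_or_ge i (n + m) with hi | hi
  · rw [Polynomial.ofFn_coeff_eq_val_of_lt _ hi]
    simp only [specPatMatrix, hj, dite_true]
    split_ifs with h₁ h₂ h₃ h₄ h₅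
    · rfl
    · exact absurd h₁.1 h₂
    · rw [h₃, Nat.add_sub_cancel_left, hlead]
    · omega
    · exact (hhigh _ (by omega)).symm
    · rfl
  · rw [Polynomial.ofFn_coeff_eq_zero_of_ge _ hi]
    split_ifs
    · exact (hhigh _ (by omega)).symm
    · rfl

open Classical in
/-- If the polynomials with coefficient vectors `vₖ` are independent on the points `tᵢ`, then
the specialization at the coefficients of `∏ᵢ (X - tᵢ)` is nonsingular. -/
theorem det_specPatMatrix_ne_zero {K : Type} [Field K] {n m : ℕ}
    {v : Fin n → Fin (n + m) → K} {t : Fin n → K}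
    (ht : LinearIndependent K fun i k => (Polynomial.ofFn (n + m) (v k)).eval (t i)) :
    (specPatMatrix K n m
      (fun i => (∏ l, (Polynomial.X - Polynomial.C (t l))).coeff i) v).det ≠ 0 := by
  set f : Polynomial K := ∏ l, (Polynomial.X - Polynomial.C (t l)) with hfdef
  have hf : f.Monic := Polynomial.monic_prod_of_monic _ _ fun l _ => Polynomial.monic_X_sub_C _
  have hdeg : f.natDegree = n := by simp [hfdef]
  have hroot (i : Fin n) : f.eval (t i) = 0 := by
    rw [hfdef, Polynomial.eval_prod]
    exact Finset.prod_eq_zero (Finset.mem_univ i) (by simp)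
  rw [Ne, ← Matrix.exists_mulVec_eq_zero_iff]
  rintro ⟨c, hc, hMc⟩
  apply hc
  let e : Fin (m + n) ≃ Fin (n + m) := finCongr (add_comm m n)
  have hsum : ∑ j, c j • Polynomial.ofFn (n + m) (fun i =>
      specPatMatrix K n m (fun i => f.coeff i) v i j) = 0 := by
    rw [← map_zero (Polynomial.ofFn (R := K) (n + m)), ← hMc]
    simp only [← map_smul, ← map_sum]
    congr 1
    ext i
    simp [Matrix.mulVec, dotProduct, mul_comm]
  have hsplit : (∑ j : Fin m, c (e (Fin.castAdd n j)) • (Polynomial.X ^ (j : ℕ) * f)) +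
      ∑ k : Fin n, c (e (Fin.natAdd m k)) • Polynomial.ofFn (n + m) (v k) = 0 := by
    rw [← hsum, ← e.sum_comp, Fin.sum_univ_add]
    congr 1
    · refine Finset.sum_congr rfl fun j _ => ?_
      rw [ofFn_specPatMatrix_of_lt hf hdeg v (by simp [e])]
      simp [e]
    · refine Finset.sum_congr rfl fun k _ => ?_
      simp [e, specPatMatrix]
  have hv (k : Fin n) : c (e (Fin.natAdd m k)) = 0 := by
    let B : Matrix (Fin n) (Fin n) K :=
      Matrix.of fun i k => (Polynomial.ofFn (n + m) (v k)).eval (t i)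
    have hinj : Function.Injective B.mulVec := Matrix.mulVec_injective_iff_isUnit.2
      (Matrix.linearIndependent_rows_iff_isUnit.1 ht)
    refine congrFun (hinj (a₁ := fun k => c (e (Fin.natAdd m k))) (a₂ := 0) ?_) k
    rw [Matrix.mulVec_zero]
    ext i
    have heval := congrArg (Polynomial.eval (t i)) hsplit
    simpa [Polynomial.eval_finsetSum, hroot, B, Matrix.mulVec, dotProduct, mul_comm] using heval
  have hw (j : Fin m) : c (e (Fin.castAdd n j)) = 0 := by
    simp only [hv, zero_smul, Finset.sum_const_zero, add_zero, ← smul_mul_assoc,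
      ← Finset.sum_mul] at hsplit
    have hzero := (mul_eq_zero.1 hsplit).resolve_right hf.ne_zero
    have hcoeff := congrArg (fun p => Polynomial.coeff p j) hzero
    simpa [Polynomial.finsetSum_coeff, Polynomial.coeff_X_pow, Fin.val_inj] using hcoeff
  funext j
  obtain ⟨j, rfl⟩ := e.surjective j
  induction j using Fin.addCases with
  | left j => exact hw j
  | right k => exact hv k

open Classical in
theorem linearIndependent_eval_ofFn {K : Type*} [Field K] [Infinite K] {N : ℕ} {ι : Type*}
    {v : ι → Fin N → K} (hv : LinearIndependent K v) :
    LinearIndependent K fun k (x : K) => (Polynomial.ofFn N (v k)).eval x := by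
  let φ : (Fin N → K) →ₗ[K] K → K :=
    (LinearMap.pi Polynomial.leval).comp (Polynomial.ofFn N)
  refine hv.map' φ (LinearMap.ker_eq_bot.2 fun p q hpq => Polynomial.injective_ofFn N ?_)
  exact Polynomial.funext fun x => congrFun hpq x

/-- if `v₁, …, vₙ ∈ K^{n+m}` are linearly independent over a field
`K` of characteristic zero, then there is a nonzero polynomial
`Δ ∈ K[x₁,…,xₙ]` such that for every `a ∈ Kⁿ` with `Δ(a) ≠ 0` the specialized
pattern vectors `w₁(a), …, w_m(a)` together with `v₁, …, vₙ` form a basis of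
`K^{n+m}` (they are linearly independent and span), and in particular there is at
least one `a ∈ Kⁿ` for which `w₁(a), …, w_m(a), v₁, …, vₙ` are linearly
independent over `K`. -/
theorem exists_good_specialization (K : Type) [Field K] [CharZero K]
    (n m : ℕ) (hn : 1 ≤ n) (hm : 1 ≤ m)
    (v : Fin n → Fin (n + m) → K) (hv : LinearIndependent K v) :
    (∃ Δ : MvPolynomial (Fin n) K, Δ ≠ 0 ∧
        ∀ a : Fin n → K, MvPolynomial.eval a Δ ≠ 0 →
          (LinearIndependent K
              (fun (j : Fin (n + m)) (i : Fin (n + m)) => specPatMatrix K n m a v i j) ∧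
            Submodule.span K
              (Set.range (fun (j : Fin (n + m)) (i : Fin (n + m)) =>
                specPatMatrix K n m a v i j)) = ⊤))
      ∧ ∃ a : Fin n → K,
          LinearIndependent K
            (fun (j : Fin (n + m)) (i : Fin (n + m)) => specPatMatrix K n m a v i j) := by
  have hbasis (a : Fin n → K) (ha : (specPatMatrix K n m a v).det ≠ 0) :
      LinearIndependent K
        (fun (j : Fin (n + m)) (i : Fin (n + m)) => specPatMatrix K n m a v i j) :=
    Matrix.linearIndependent_cols_iff_isUnit.2
      ((Matrix.isUnit_iff_isUnit_det _).2 (isUnit_iff_ne_zero.2 ha))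
  obtain ⟨t, ht⟩ := exists_points_linearIndependent_eval (linearIndependent_eval_ofFn hv)
  have hdet := det_specPatMatrix_ne_zero ht
  refine ⟨⟨(genericPatMatrix K n m v).det, fun h => hdet ?_, fun a ha => ?_⟩, _, hbasis _ hdet⟩
  · rw [← eval_det_genericPatMatrix, h, map_zero]
  · rw [eval_det_genericPatMatrix] at ha
    exact ⟨hbasis a ha, (hbasis a ha).span_eq_top_of_card_eq_finrank' (by simp)⟩
end

section
/- Let K be a field of characteristic zero, let n, m ≥ 1 be integers, and let F = K(y₀, …, y_{n−1}) be the field of rational functions in n indeterminates over K (the fraction field of the multivariate polynomial ring K[y₀,…,y_{n−1}]). Let A(t) = tⁿ + y_{n−1}t^{n−1} + ⋯ + y₁t + y₀ ∈ F[t]. Suppose p₁, …, pₙ ∈ K[t] are polynomials of degree at most n+m−1 that are linearly independent over K. Then the n+m polynomials A(t), t·A(t), t²·A(t), …, t^{m−1}·A(t), p₁(t), …, pₙ(t) (with p₁, …, pₙ viewed in F[t] via the inclusion K ⊆ F) are linearly independent over F; equivalently, they form a basis of the F-vector space of polynomials in F[t] of degree at most n+m−1. -/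
open Polynomial in
/-- If a family of `N` polynomials of degree less than `N` becomes linearly independent after
specializing the coefficients along `f`, then it is linearly independent after any injective
extension of the coefficients. -/
theorem linearIndependent_map_of_specialization {ι R K L : Type*} [Fintype ι] [CommRing R]
    [Field K] [Field L] (f : R →+* K) (g : R →+* L) (hg : Function.Injective g)
    {N : ℕ} (e : ι ≃ Fin N) (v : ι → R[X]) (hdeg : ∀ i, (v i).degree < N)
    (h : LinearIndependent K fun i => (v i).map f) :
    LinearIndependent L fun i => (v i).map g := by
  classical
  let M : Matrix ι ι R := Matrix.of fun i j => (v i).coeff (e j)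
  have hrow : LinearIndependent K (f.mapMatrix M).row := by
    rw [Fintype.linearIndependent_iff] at h ⊢
    intro c hc
    refine h c (Polynomial.ext fun k => ?_)
    by_cases hk : k < N
    · simpa [M, finsetSum_coeff] using congrFun hc (e.symm ⟨k, hk⟩)
    · rw [finsetSum_coeff, coeff_zero]
      refine Finset.sum_eq_zero fun i _ => ?_
      have hlt : (v i).degree < k := (hdeg i).trans_le (by exact_mod_cast not_lt.mp hk)
      simp [coeff_eq_zero_of_degree_lt hlt]
  have hdet : M.det ≠ 0 := by
    intro h0
    have hu := (Matrix.isUnit_iff_isUnit_det _).mp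
      (Matrix.linearIndependent_rows_iff_isUnit.mp hrow)
    rw [← RingHom.map_det, h0, map_zero] at hu
    exact not_isUnit_zero hu
  have hrow' : LinearIndependent L (g.mapMatrix M).row := by
    rw [Matrix.linearIndependent_rows_iff_isUnit, Matrix.isUnit_iff_isUnit_det,
      ← RingHom.map_det, isUnit_iff_ne_zero]
    exact (map_ne_zero_iff g hg).mpr hdet
  let φ : L[X] →ₗ[L] ι → L := LinearMap.pi fun j => lcoeff L (e j)
  refine LinearIndependent.of_comp φ ?_
  have hφ : (φ ∘ fun i => (v i).map g) = (g.mapMatrix M).row := by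
    ext i j
    simp [φ, M]
  rwa [hφ]

open Polynomial in
/-- Linearly independent polynomials over an infinite field are separated by
as many evaluation points. -/
theorem exists_points_of_linearIndependent {K : Type*} [Field K] [Infinite K] {n : ℕ}
    (p : Fin n → K[X]) (hp : LinearIndependent K p) :
    ∃ a : Fin n → K, ∀ c : Fin n → K, (∀ j, ∑ i, c i * (p i).eval (a j) = 0) → c = 0 := by
  let w : K → Fin n → K := fun x i => (p i).eval x
  have hspan : Submodule.span K (Set.range w) = ⊤ := by
    by_contra hne
    obtain ⟨φ, hφ, hle⟩ := Submodule.exists_le_ker_of_lt_top _ (lt_top_iff_ne_top.mpr hne)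
    have hsum : ∑ i, φ (Pi.single i 1) • p i = 0 := by
      refine Polynomial.funext fun x => ?_
      have hx : φ (w x) = 0 := hle (Submodule.subset_span ⟨x, rfl⟩)
      rw [← Finset.univ_sum_single (w x), map_sum] at hx
      have hs (i : Fin n) : φ (Pi.single i (w x i)) = φ (Pi.single i 1) * (p i).eval x := by
        rw [mul_comm, ← smul_eq_mul, ← map_smul, ← Pi.single_smul, smul_eq_mul, mul_one]
      simpa [eval_finsetSum, hs] using hx
    have hz := Fintype.linearIndependent_iff.mp hp _ hsum
    exact hφ (LinearMap.pi_ext' fun i => LinearMap.ext_ring (by simpa using hz i))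
  obtain ⟨b, hb, hbs, -⟩ := Submodule.exists_fun_fin_finrank_span_eq K (Set.range w)
  have hn : Module.finrank K (Submodule.span K (Set.range w)) = n := by
    rw [hspan, finrank_top, Module.finrank_fin_fun]
  choose a ha using hb
  refine ⟨fun j => a (Fin.cast hn.symm j), fun c hc => ?_⟩
  have hle : Submodule.span K (Set.range b) ≤ LinearMap.ker (Fintype.linearCombination K c) := by
    rw [Submodule.span_le]
    rintro _ ⟨k, rfl⟩
    have := hc (Fin.cast hn k)
    simpa [← ha k, w, Fintype.linearCombination_apply, mul_comm] using this
  rw [hbs, hspan] at hle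
  ext i
  classical
  simpa [Fintype.linearCombination_apply_single] using
    hle (Submodule.mem_top (x := Pi.single i (1 : K)))

open Polynomial in
/-- If `p` is separated by the points `a`, then `p` together with the multiples `X ^ j * A` of
a nonzero polynomial `A` vanishing at these points is linearly independent. -/
theorem linearIndependent_multiples_of_points {K : Type*} [Field K] {n m : ℕ}
    (p : Fin n → K[X]) (a : Fin n → K)
    (ha : ∀ c : Fin n → K, (∀ j, ∑ i, c i * (p i).eval (a j) = 0) → c = 0)
    {A : K[X]} (hA : A ≠ 0) (hroot : ∀ j, A.eval (a j) = 0) :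
    LinearIndependent K (Sum.elim (fun j : Fin m => X ^ (j : ℕ) * A) p) := by
  rw [Fintype.linearIndependent_iff]
  intro g hg
  rw [Fintype.sum_sum_type] at hg
  simp only [Sum.elim_inl, Sum.elim_inr] at hg
  have hr : (fun i => g (Sum.inr i)) = 0 := ha _ fun j => by
    simpa [eval_finsetSum, hroot] using congrArg (eval (a j)) hg
  have hr' : ∀ i, g (Sum.inr i) = 0 := fun i => congrFun hr i
  have hq : ∑ j : Fin m, g (Sum.inl j) • (X : K[X]) ^ (j : ℕ) = 0 := by
    simp only [hr', zero_smul, Finset.sum_const_zero, add_zero, ← smul_mul_assoc,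
      ← Finset.sum_mul] at hg
    exact (mul_eq_zero.mp hg).resolve_right hA
  rintro (j | i)
  · simpa [finsetSum_coeff, coeff_X_pow, Fin.val_inj] using congrArg (fun q => coeff q j) hq
  · exact hr' i

/-- polynomial reformulation of the determinant lemma: let `K`
be a field of characteristic zero, let `F = K(y₀, …, y_{n-1})` be the rational
function field in `n` indeterminates over `K` (the fraction field of the
multivariate polynomial ring), and let
`A(t) = tⁿ + y_{n-1} t^{n-1} + ⋯ + y₁ t + y₀ ∈ F[t]`.  If `p₁, …, pₙ ∈ K[t]` are
polynomials of degree at most `n+m-1` that are linearly independent over `K`, then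
the `n+m` polynomials `A, t·A, …, t^{m-1}·A, p₁, …, pₙ` (with the `pᵢ` viewed in
`F[t]` via `K ⊆ F`) are linearly independent over `F`. -/
theorem generic_monic_multiples_linearIndependent (K : Type) [Field K] [CharZero K]
    (n m : ℕ) (hn : 1 ≤ n) (hm : 1 ≤ m)
    (p : Fin n → Polynomial K)
    (hdeg : ∀ i, (p i).degree ≤ ((n + m - 1 : ℕ) : WithBot ℕ))
    (hp : LinearIndependent K p) :
    LinearIndependent (FractionRing (MvPolynomial (Fin n) K))
      (Sum.elim
        (fun j : Fin m =>
          Polynomial.X ^ (j : ℕ) *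
            (Polynomial.X ^ n +
              ∑ i : Fin n,
                Polynomial.C
                    (algebraMap (MvPolynomial (Fin n) K)
                      (FractionRing (MvPolynomial (Fin n) K)) (MvPolynomial.X i)) *
                  Polynomial.X ^ (i : ℕ)))
        (fun i : Fin n =>
          (p i).map
            ((algebraMap (MvPolynomial (Fin n) K)
                (FractionRing (MvPolynomial (Fin n) K))).comp MvPolynomial.C))) := by
  classical
  obtain ⟨a, ha⟩ := exists_points_of_linearIndependent p hp
  let B : Polynomial K := ∏ j, (Polynomial.X - Polynomial.C (a j))
  have hBmonic : B.Monic := Polynomial.monic_prod_X_sub_C a Finset.univ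
  have hBdeg : B.natDegree = n := by simp [B]
  let A : Polynomial (MvPolynomial (Fin n) K) := Polynomial.X ^ n +
    ∑ i : Fin n, Polynomial.C (MvPolynomial.X i) * Polynomial.X ^ (i : ℕ)
  let f : MvPolynomial (Fin n) K →+* K := MvPolynomial.eval fun i => B.coeff i
  have hAB : A.map f = B := by
    conv_rhs => rw [hBmonic.as_sum, hBdeg, ← Fin.sum_univ_eq_sum_range
      (fun i => Polynomial.C (B.coeff i) * Polynomial.X ^ i)]
    simp [A, f, Polynomial.map_sum]
  have hAdeg : A.degree ≤ n := by
    refine (Polynomial.degree_add_le _ _).trans (max_le (Polynomial.degree_X_pow_le n) ?_)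
    refine (Polynomial.degree_sum_le _ _).trans (Finset.sup_le fun i _ => ?_)
    exact (Polynomial.degree_C_mul_X_pow_le _ _).trans (by exact_mod_cast i.2.le)
  let v : Fin m ⊕ Fin n → Polynomial (MvPolynomial (Fin n) K) :=
    Sum.elim (fun j : Fin m => Polynomial.X ^ (j : ℕ) * A) fun i => (p i).map MvPolynomial.C
  have hspec : LinearIndependent K fun i => (v i).map f := by
    have hfC : f.comp MvPolynomial.C = RingHom.id K := by ext; simp [f]
    convert linearIndependent_multiples_of_points (m := m) p a ha hBmonic.ne_zero
      (fun j => by simp [B, Polynomial.eval_prod, Finset.prod_eq_zero_iff, sub_eq_zero]) using 1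
    funext i
    rcases i with j | i
    · simp [v, hAB]
    · simp [v, Polynomial.map_map, hfC]
  have hvdeg : ∀ i, (v i).degree < ((m + n : ℕ) : WithBot ℕ) := by
    rintro (j | i)
    · refine (Polynomial.degree_mul_le _ _).trans_lt
        ((add_le_add (Polynomial.degree_X_pow_le _) hAdeg).trans_lt ?_)
      exact_mod_cast Nat.add_lt_add_right j.2 n
    · refine Polynomial.degree_map_le.trans_lt ((hdeg i).trans_lt ?_)
      exact_mod_cast (by omega : n + m - 1 < m + n)
  let g := algebraMap (MvPolynomial (Fin n) K) (FractionRing (MvPolynomial (Fin n) K))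
  have key := linearIndependent_map_of_specialization f g (IsFractionRing.injective _ _)
    finSumFinEquiv v hvdeg hspec
  have hv : (fun i => (v i).map g) = Sum.elim
      (fun j : Fin m => Polynomial.X ^ (j : ℕ) * (Polynomial.X ^ n +
        ∑ i : Fin n, Polynomial.C (g (MvPolynomial.X i)) * Polynomial.X ^ (i : ℕ)))
      (fun i => (p i).map (g.comp MvPolynomial.C)) := by
    funext i
    rcases i with j | i
    · simp [v, A, Polynomial.map_sum]
    · simp [v, Polynomial.map_map]
  rw [hv] at key
  exact key
end
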